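/- arXiv:1803.08308 — 4 statements merged into one kernel-verified Lean document; each statement's English description precedes it below -/
import Mathlib

section
/- Let m ∈ ℝ, let γ = (γ₀, γ₁, γ₂, γ₃) ∈ ℝ⁴, and let φ : ℝ⁴ → ℝ, (x⁰, x¹, x², x³) ↦ φ(x), be C². Suppose that for every smooth function η : ℝ⁴ → ℝ with compact support, the map ε ↦ ∫_{ℝ⁴} e^{γ₀ x⁰ + γ₁ x¹ + γ₂ x² + γ₃ x³} [ (1/2)( (∂₀(φ+εη))² − (∂₁(φ+εη))² − (∂₂(φ+εη))² − (∂₃(φ+εη))² ) − (m²/2)(φ + εη)² ] d⁴x is well defined and has derivative 0 at ε = 0. Then φ satisfies the damped Klein–Gordon equation ∂₀₀φ − ∂₁₁φ − ∂₂₂φ − ∂₃₃φ + γ₀ ∂₀φ − γ₁ ∂₁φ − γ₂ ∂₂φ − γ₃ ∂₃φ + m² φ = 0 everywhere. -/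
open MeasureTheory Real

/-- Partial derivative `∂_μ` of a real-valued function on `ℝ⁴`. -/
noncomputable def pd (μ : Fin 4) (F : EuclideanSpace ℝ (Fin 4) → ℝ)
    (x : EuclideanSpace ℝ (Fin 4)) : ℝ :=
  fderiv ℝ F x (EuclideanSpace.single μ 1)

/-- The exponential weight `exp(γ_μ x^μ)` of the action. -/
noncomputable def expWeight (γ : Fin 4 → ℝ) (x : EuclideanSpace ℝ (Fin 4)) : ℝ :=
  Real.exp (γ 0 * x 0 + γ 1 * x 1 + γ 2 * x 2 + γ 3 * x 3)

theorem contDiff_expWeight (γ : Fin 4 → ℝ) {n : WithTop ℕ∞} : ContDiff ℝ n (expWeight γ) := by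
  unfold expWeight
  fun_prop

theorem pd_expWeight (γ : Fin 4 → ℝ) (μ : Fin 4) (x : EuclideanSpace ℝ (Fin 4)) :
    pd μ (expWeight γ) x = γ μ * expWeight γ x := by
  have hcoord (i : Fin 4) : HasFDerivAt (fun y : EuclideanSpace ℝ (Fin 4) => γ i * y i)
      (γ i • EuclideanSpace.proj (𝕜 := ℝ) i) x :=
    (EuclideanSpace.proj (𝕜 := ℝ) i : EuclideanSpace ℝ (Fin 4) →L[ℝ] ℝ).hasFDerivAt.const_mul (γ i)
  have h := ((((hcoord 0).add (hcoord 1)).add (hcoord 2)).add (hcoord 3)).exp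
  have h' : pd μ (expWeight γ) x = _ :=
    congrArg (fun L => L (EuclideanSpace.single μ 1)) h.fderiv
  rw [h']
  fin_cases μ <;> simp [expWeight, mul_comm]

theorem pd_add_const_mul {F G : EuclideanSpace ℝ (Fin 4) → ℝ} (hF : Differentiable ℝ F)
    (hG : Differentiable ℝ G) (ε : ℝ) (μ : Fin 4) (x : EuclideanSpace ℝ (Fin 4)) :
    pd μ (fun y => F y + ε * G y) x = pd μ F x + ε * pd μ G x := by
  have h := (hF x).hasFDerivAt.add ((hG x).hasFDerivAt.const_mul ε)
  have h' : pd μ (fun y => F y + ε * G y) x = _ :=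
    congrArg (fun L => L (EuclideanSpace.single μ 1)) h.fderiv
  rw [h']
  simp [pd]

theorem pd_mul {F G : EuclideanSpace ℝ (Fin 4) → ℝ} (hF : Differentiable ℝ F)
    (hG : Differentiable ℝ G) (μ : Fin 4) (x : EuclideanSpace ℝ (Fin 4)) :
    pd μ (fun y => F y * G y) x = F x * pd μ G x + G x * pd μ F x := by
  have h' : pd μ (fun y => F y * G y) x = _ :=
    congrArg (fun L => L (EuclideanSpace.single μ 1))
      ((hF x).hasFDerivAt.mul (hG x).hasFDerivAt).fderiv
  rw [h']
  simp [pd]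

theorem ContDiff.pd {n k : WithTop ℕ∞} {F : EuclideanSpace ℝ (Fin 4) → ℝ} (hF : ContDiff ℝ n F)
    (hk : k + 1 ≤ n) (μ : Fin 4) : ContDiff ℝ k (pd μ F) :=
  (hF.fderiv_right hk).clm_apply contDiff_const

theorem HasCompactSupport.pd {F : EuclideanSpace ℝ (Fin 4) → ℝ} (hF : HasCompactSupport F)
    (μ : Fin 4) : HasCompactSupport (pd μ F) :=
  hF.fderiv_apply ℝ _

/-- Integration by parts against a compactly supported test function. -/
theorem integral_mul_pd_eq {F η : EuclideanSpace ℝ (Fin 4) → ℝ} (hF : ContDiff ℝ 1 F)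
    (hη : ContDiff ℝ 1 η) (hc : HasCompactSupport η) (μ : Fin 4) :
    ∫ x, F x * pd μ η x = -∫ x, pd μ F x * η x := by
  have hF' : Continuous (pd μ F) := (hF.pd (k := 0) (by simp) μ).continuous
  have hη' : Continuous (pd μ η) := (hη.pd (k := 0) (by simp) μ).continuous
  exact integral_mul_fderiv_eq_neg_fderiv_mul_of_integrable
    ((hF'.mul hη.continuous).integrable_of_hasCompactSupport hc.mul_left)
    ((hF.continuous.mul hη').integrable_of_hasCompactSupport (hc.pd μ).mul_left)
    ((hF.continuous.mul hη.continuous).integrable_of_hasCompactSupport hc.mul_left)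
    (fun x _ => hF.differentiable one_ne_zero x) (fun x _ => hη.differentiable one_ne_zero x)

/-- The first variation is the linear coefficient of a quadratic perturbation. -/
theorem integral_eq_zero_of_hasDerivAt_quadratic {α : Type*} [MeasurableSpace α] {μ : Measure α}
    {A B C : α → ℝ} (hA : Integrable A μ) (hB : Integrable B μ) (hC : Integrable C μ)
    (h : HasDerivAt (fun ε : ℝ => ∫ x, (A x + ε * B x + ε ^ 2 * C x) ∂μ) 0 0) :
    ∫ x, B x ∂μ = 0 := by
  have heq : (fun ε : ℝ => ∫ x, (A x + ε * B x + ε ^ 2 * C x) ∂μ) =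
      fun ε : ℝ => ∫ x, A x ∂μ + ε * ∫ x, B x ∂μ + ε ^ 2 * ∫ x, C x ∂μ := by
    funext ε
    rw [integral_add (by fun_prop) (hC.const_mul _), integral_add hA (hB.const_mul ε),
      integral_const_mul, integral_const_mul]
  rw [heq] at h
  have h2 := (((hasDerivAt_id (0 : ℝ)).mul_const (∫ x, B x ∂μ)).const_add (∫ x, A x ∂μ)).add
    (((hasDerivAt_id (0 : ℝ)).pow 2).mul_const (∫ x, C x ∂μ))
  simpa using h2.unique h

/-- Non-conservative Klein–Gordon equation: stationarity of the classical
Klein–Gordon action weighted by `exp(γ_μ x^μ)` yields the damped Klein–Gordon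
equation `∂_μ∂^μ φ + γ_μ ∂^μ φ + m² φ = 0` in the Minkowski metric
`diag(1, −1, −1, −1)`. -/
theorem stmt_8 (m : ℝ) (γ : Fin 4 → ℝ)
    (φ : EuclideanSpace ℝ (Fin 4) → ℝ) (hφ : ContDiff ℝ 2 φ)
    (hvar : ∀ η : EuclideanSpace ℝ (Fin 4) → ℝ,
      ContDiff ℝ (⊤ : ℕ∞) η → HasCompactSupport η →
      (∀ ε : ℝ, Integrable (fun x : EuclideanSpace ℝ (Fin 4) =>
        Real.exp (γ 0 * x 0 + γ 1 * x 1 + γ 2 * x 2 + γ 3 * x 3) *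
          (1 / 2 * ((pd 0 (fun y => φ y + ε * η y) x) ^ 2
              - (pd 1 (fun y => φ y + ε * η y) x) ^ 2
              - (pd 2 (fun y => φ y + ε * η y) x) ^ 2
              - (pd 3 (fun y => φ y + ε * η y) x) ^ 2)
            - m ^ 2 / 2 * (φ x + ε * η x) ^ 2))) ∧
      HasDerivAt (fun ε : ℝ => ∫ x : EuclideanSpace ℝ (Fin 4),
        Real.exp (γ 0 * x 0 + γ 1 * x 1 + γ 2 * x 2 + γ 3 * x 3) *
          (1 / 2 * ((pd 0 (fun y => φ y + ε * η y) x) ^ 2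
              - (pd 1 (fun y => φ y + ε * η y) x) ^ 2
              - (pd 2 (fun y => φ y + ε * η y) x) ^ 2
              - (pd 3 (fun y => φ y + ε * η y) x) ^ 2)
            - m ^ 2 / 2 * (φ x + ε * η x) ^ 2)) 0 0) :
    ∀ x : EuclideanSpace ℝ (Fin 4),
      pd 0 (pd 0 φ) x - pd 1 (pd 1 φ) x - pd 2 (pd 2 φ) x - pd 3 (pd 3 φ) x
        + γ 0 * pd 0 φ x - γ 1 * pd 1 φ x - γ 2 * pd 2 φ x - γ 3 * pd 3 φ x
        + m ^ 2 * φ x = 0 := by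
  set W := expWeight γ with hW
  have hWd : ∀ {n : WithTop ℕ∞}, ContDiff ℝ n W := contDiff_expWeight γ
  have hφd : Differentiable ℝ φ := hφ.differentiable (by simp)
  have hφ1 (μ : Fin 4) : ContDiff ℝ 1 (pd μ φ) := hφ.pd (by norm_num) μ
  have hφc (μ : Fin 4) : Continuous (pd μ φ) := (hφ1 μ).continuous
  have hφcc (μ : Fin 4) : Continuous (pd μ (pd μ φ)) :=
    ((hφ1 μ).pd (k := 0) (by simp) μ).continuous
  have hφ0 : Continuous φ := hφ.continuous
  have hWc : Continuous W := (hWd (n := 0)).continuous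
  set E : EuclideanSpace ℝ (Fin 4) → ℝ := fun x =>
    pd 0 (pd 0 φ) x - pd 1 (pd 1 φ) x - pd 2 (pd 2 φ) x - pd 3 (pd 3 φ) x
        + γ 0 * pd 0 φ x - γ 1 * pd 1 φ x - γ 2 * pd 2 φ x - γ 3 * pd 3 φ x
        + m ^ 2 * φ x with hE
  have hEc : Continuous E := by fun_prop
  have key : ∀ η : EuclideanSpace ℝ (Fin 4) → ℝ, ContDiff ℝ (⊤ : ℕ∞) η → HasCompactSupport η →
      ∫ x, η x • (W x * E x) = 0 := by
    intro η hη hc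
    obtain ⟨hint, hder⟩ := hvar η hη hc
    have hη0 : Continuous η := hη.continuous
    have hη1 : ContDiff ℝ 1 η := hη.of_le (by exact_mod_cast le_top)
    have hηd : Differentiable ℝ η := hη1.differentiable (by simp)
    have hηc (μ : Fin 4) : Continuous (pd μ η) := (hη1.pd (k := 0) (by simp) μ).continuous
    have hWφ (μ : Fin 4) : ContDiff ℝ 1 (fun x => W x * pd μ φ x) := hWd.mul (hφ1 μ)
    have hP (μ : Fin 4) : Integrable (fun x => W x * pd μ φ x * pd μ η x) :=
      ((hWφ μ).continuous.mul (hηc μ)).integrable_of_hasCompactSupport (hc.pd μ).mul_left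
    have hQ (μ : Fin 4) : Integrable (fun x => pd μ (fun x => W x * pd μ φ x) x * η x) :=
      (((hWφ μ).pd (k := 0) (by simp) μ).continuous.mul hη0).integrable_of_hasCompactSupport
        hc.mul_left
    have hR : Integrable (fun x => W x * (m ^ 2 * φ x) * η x) :=
      Continuous.integrable_of_hasCompactSupport (by fun_prop) hc.mul_left
    have hS (μ : Fin 4) : Integrable (fun x => W x * pd μ η x * pd μ η x) :=
      Continuous.integrable_of_hasCompactSupport (by fun_prop) (hc.pd μ).mul_left
    have hT : Integrable (fun x => W x * (m ^ 2 / 2 * η x) * η x) :=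
      Continuous.integrable_of_hasCompactSupport (by fun_prop) hc.mul_left
    have hB := integral_eq_zero_of_hasDerivAt_quadratic (hint 0)
      (((((hP 0).sub (hP 1)).sub (hP 2)).sub (hP 3)).sub hR)
      (((((hS 0).sub (hS 1)).sub (hS 2)).sub (hS 3)).const_mul (1 / 2) |>.sub hT) <| by
        refine hder.congr_of_eventuallyEq
          (.of_forall fun ε => integral_congr_ae (.of_forall fun x => ?_))
        simp only [pd_add_const_mul hφd hηd, Pi.sub_apply, hW, expWeight]
        ring
    have hB' : ∫ x, (W x * pd 0 φ x * pd 0 η x - W x * pd 1 φ x * pd 1 η x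
        - W x * pd 2 φ x * pd 2 η x - W x * pd 3 φ x * pd 3 η x
        - W x * (m ^ 2 * φ x) * η x) = 0 := hB
    rw [integral_sub (by fun_prop) hR, integral_sub (by fun_prop) (hP 3),
      integral_sub (by fun_prop) (hP 2), integral_sub (hP 0) (hP 1)] at hB'
    simp only [fun μ => integral_mul_pd_eq (hWφ μ) hη1 hc μ] at hB'
    have hsplit : ∀ x, η x • (W x * E x) =
        pd 0 (fun x => W x * pd 0 φ x) x * η x - pd 1 (fun x => W x * pd 1 φ x) x * η x
        - pd 2 (fun x => W x * pd 2 φ x) x * η x - pd 3 (fun x => W x * pd 3 φ x) x * η x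
        + W x * (m ^ 2 * φ x) * η x := by
      intro x
      have hprod (μ : Fin 4) : pd μ (fun x => W x * pd μ φ x) x =
          W x * pd μ (pd μ φ) x + pd μ φ x * (γ μ * W x) := by
        rw [pd_mul (hWd.differentiable one_ne_zero) ((hφ1 μ).differentiable one_ne_zero),
          pd_expWeight]
      simp only [hprod, hE, smul_eq_mul]
      ring
    simp only [hsplit]
    rw [integral_add (by fun_prop) hR, integral_sub (by fun_prop) (hQ 3),
      integral_sub (by fun_prop) (hQ 2), integral_sub (hQ 0) (hQ 1)]
    linarith
  have hae : ∀ᵐ x, W x * E x = 0 :=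
    ae_eq_zero_of_integral_contDiff_smul_eq_zero (hWc.mul hEc).locallyIntegrable key
  have hzero : (fun x => W x * E x) = fun _ => 0 :=
    Continuous.ae_eq_iff_eq volume (hWc.mul hEc) continuous_const |>.1 hae
  intro x
  exact (mul_eq_zero.1 (congrFun hzero x)).resolve_left (Real.exp_pos _).ne'
end

section
/- Let c > 0, γ₀, k ∈ ℝ with γ₀² = 4k², let A, B ∈ ℂ, and define u : ℝ² → ℂ by u(t, z) = (A + B c t) · exp( −(γ₀/2) c t ) · exp( i k z ). Then u satisfies (1/c²) ∂_{tt} u − ∂_{zz} u + (γ₀/c) ∂_t u = 0 at every (t, z) ∈ ℝ². -/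
open Complex Real

/-- Partial time derivative of a complex-valued function on `ℝ × ℝ = (t, z)`. -/
noncomputable def pdtC (F : ℝ × ℝ → ℂ) (p : ℝ × ℝ) : ℂ :=
  fderiv ℝ F p (1, 0)

/-- Partial space derivative of a complex-valued function on `ℝ × ℝ = (t, z)`. -/
noncomputable def pdzC (F : ℝ × ℝ → ℂ) (p : ℝ × ℝ) : ℂ :=
  fderiv ℝ F p (0, 1)

/-- A plane wave with amplitude affine in time, `(a + b t) e^{w t} e^{κ z}`. -/
noncomputable def affineWave (a b w κ : ℂ) (p : ℝ × ℝ) : ℂ :=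
  (a + b * (p.1 : ℂ)) * Complex.exp (w * (p.1 : ℂ)) * Complex.exp (κ * (p.2 : ℂ))

lemma differentiable_affineWave (a b w κ : ℂ) : Differentiable ℝ (affineWave a b w κ) := by
  have h₁ : Differentiable ℝ fun p : ℝ × ℝ => (p.1 : ℂ) :=
    Complex.ofRealCLM.differentiable.comp differentiable_fst
  have h₂ : Differentiable ℝ fun p : ℝ × ℝ => (p.2 : ℂ) :=
    Complex.ofRealCLM.differentiable.comp differentiable_snd
  exact (((h₁.const_mul b).const_add a).mul (h₁.const_mul w).cexp).mul (h₂.const_mul κ).cexp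

lemma pdtC_affineWave (a b w κ : ℂ) :
    pdtC (affineWave a b w κ) = affineWave (b + w * a) (w * b) w κ := by
  funext ⟨t, z⟩
  have hline : HasDerivAt (fun s : ℝ => (s, z)) ((1 : ℝ), (0 : ℝ)) t :=
    (hasDerivAt_id t).prodMk (hasDerivAt_const t z)
  have hchain := (differentiable_affineWave a b w κ (t, z)).hasFDerivAt.comp_hasDerivAt t hline
  have ht : HasDerivAt (fun s : ℝ => (s : ℂ)) 1 t := (hasDerivAt_id t).ofReal_comp
  have hdirect := (((ht.const_mul b).const_add a).mul (ht.const_mul w).cexp).mul_const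
    (Complex.exp (κ * (z : ℂ)))
  refine (hchain.unique hdirect).trans ?_
  simp only [affineWave]
  ring

lemma pdzC_affineWave (a b w κ : ℂ) :
    pdzC (affineWave a b w κ) = affineWave (κ * a) (κ * b) w κ := by
  funext ⟨t, z⟩
  have hline : HasDerivAt (fun s : ℝ => (t, s)) ((0 : ℝ), (1 : ℝ)) z :=
    (hasDerivAt_const z t).prodMk (hasDerivAt_id z)
  have hchain := (differentiable_affineWave a b w κ (t, z)).hasFDerivAt.comp_hasDerivAt z hline
  have hz : HasDerivAt (fun s : ℝ => (s : ℂ)) 1 z := (hasDerivAt_id z).ofReal_comp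
  have hdirect := (hz.const_mul κ).cexp.const_mul
    ((a + b * (t : ℂ)) * Complex.exp (w * (t : ℂ)))
  refine (hchain.unique hdirect).trans ?_
  simp only [affineWave]
  ring

/-- Critically damped solutions of the source-free damped wave equation
`(1/c²)∂_tt u − ∂_zz u + (γ₀/c)∂_t u = 0` when `γ₀² = 4k²`. -/
theorem stmt_11 (c γ₀ k : ℝ) (hc : 0 < c) (hk : γ₀ ^ 2 = 4 * k ^ 2)
    (A B : ℂ)
    (u : ℝ × ℝ → ℂ)
    (hu : u = fun p : ℝ × ℝ =>
      (A + B * (c : ℂ) * (p.1 : ℂ)) *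
        Complex.exp ((-(γ₀ : ℂ) / 2) * (c : ℂ) * (p.1 : ℂ)) *
        Complex.exp (Complex.I * (k : ℂ) * (p.2 : ℂ))) :
    ∀ p : ℝ × ℝ,
      (1 / (c : ℂ) ^ 2) * pdtC (pdtC u) p - pdzC (pdzC u) p
        + ((γ₀ : ℂ) / (c : ℂ)) * pdtC u p = 0 := by
  have hu' : u = affineWave A (B * c) (-(γ₀ : ℂ) / 2 * c) (Complex.I * k) := hu
  have hc' : (c : ℂ) ≠ 0 := by exact_mod_cast hc.ne'
  have hk' : (γ₀ : ℂ) ^ 2 = 4 * (k : ℂ) ^ 2 := by exact_mod_cast hk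
  intro p
  simp only [hu', pdtC_affineWave, pdzC_affineWave, affineWave]
  generalize Complex.exp (-(γ₀ : ℂ) / 2 * c * p.1) = E₁
  generalize Complex.exp (Complex.I * k * p.2) = E₂
  field_simp
  ring_nf
  simp only [Complex.I_sq]
  linear_combination (-(A + B * c * p.1) * E₁ * E₂) * hk'
end

section
/- Let c > 0, γ₀, k ∈ ℝ with γ₀² < 4k², let γ' = √(4k² − γ₀²), let σ ∈ {+1, −1}, and define u : ℝ² → ℂ by u(t, z) = exp( ((−γ₀ + σ i γ')/2) c t ) · exp( i k z ). Then u satisfies (1/c²) ∂_{tt} u − ∂_{zz} u + (γ₀/c) ∂_t u = 0 at every (t, z) ∈ ℝ². -/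
open Complex Real

/-- The derivative of a plane exponential on `ℝ × ℝ`, scaled by a constant. -/
theorem hasFDerivAt_const_mul_exp_mul_exp (d a b : ℂ) (p : ℝ × ℝ) :
    ∃ L : ℝ × ℝ →L[ℝ] ℂ,
      HasFDerivAt (fun p : ℝ × ℝ => d * (Complex.exp (a * p.1) * Complex.exp (b * p.2))) L p ∧
      L (1, 0) = d * a * (Complex.exp (a * p.1) * Complex.exp (b * p.2)) ∧
      L (0, 1) = d * b * (Complex.exp (a * p.1) * Complex.exp (b * p.2)) := by
  have h₁ : HasFDerivAt (fun p : ℝ × ℝ => (p.1 : ℂ))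
      (Complex.ofRealCLM.comp (ContinuousLinearMap.fst ℝ ℝ ℝ)) p :=
    (Complex.ofRealCLM.comp (ContinuousLinearMap.fst ℝ ℝ ℝ)).hasFDerivAt
  have h₂ : HasFDerivAt (fun p : ℝ × ℝ => (p.2 : ℂ))
      (Complex.ofRealCLM.comp (ContinuousLinearMap.snd ℝ ℝ ℝ)) p :=
    (Complex.ofRealCLM.comp (ContinuousLinearMap.snd ℝ ℝ ℝ)).hasFDerivAt
  refine ⟨_, ((h₁.const_mul a).cexp.mul (h₂.const_mul b).cexp).const_mul d, ?_, ?_⟩ <;>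
  · simp
    ring

theorem pdtC_const_mul_exp_mul_exp (d a b : ℂ) :
    pdtC (fun p : ℝ × ℝ => d * (Complex.exp (a * p.1) * Complex.exp (b * p.2))) =
      fun p => d * a * (Complex.exp (a * p.1) * Complex.exp (b * p.2)) := by
  funext p
  obtain ⟨L, hL, ht, -⟩ := hasFDerivAt_const_mul_exp_mul_exp d a b p
  rw [pdtC, hL.fderiv, ht]

theorem pdzC_const_mul_exp_mul_exp (d a b : ℂ) :
    pdzC (fun p : ℝ × ℝ => d * (Complex.exp (a * p.1) * Complex.exp (b * p.2))) =
      fun p => d * b * (Complex.exp (a * p.1) * Complex.exp (b * p.2)) := by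
  funext p
  obtain ⟨L, hL, -, hz⟩ := hasFDerivAt_const_mul_exp_mul_exp d a b p
  rw [pdzC, hL.fderiv, hz]

/-- Underdamped (traveling-wave) solutions of the source-free damped wave
equation `(1/c²)∂_tt u − ∂_zz u + (γ₀/c)∂_t u = 0` when `γ₀² < 4k²`. -/
theorem stmt_12 (c γ₀ k : ℝ) (hc : 0 < c) (hk : γ₀ ^ 2 < 4 * k ^ 2)
    (γ' : ℝ) (hγ' : γ' = Real.sqrt (4 * k ^ 2 - γ₀ ^ 2))
    (σ : ℝ) (hσ : σ = 1 ∨ σ = -1)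
    (u : ℝ × ℝ → ℂ)
    (hu : u = fun p : ℝ × ℝ =>
      Complex.exp (((-(γ₀ : ℂ) + (σ : ℂ) * Complex.I * (γ' : ℂ)) / 2) *
          (c : ℂ) * (p.1 : ℂ)) *
        Complex.exp (Complex.I * (k : ℂ) * (p.2 : ℂ))) :
    ∀ p : ℝ × ℝ,
      (1 / (c : ℂ) ^ 2) * pdtC (pdtC u) p - pdzC (pdzC u) p
        + ((γ₀ : ℂ) / (c : ℂ)) * pdtC u p = 0 := by
  intro p
  have hc' : (c : ℂ) ≠ 0 := mod_cast hc.ne'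
  have hγ : (γ' : ℂ) ^ 2 = 4 * (k : ℂ) ^ 2 - (γ₀ : ℂ) ^ 2 := by
    have h : γ' ^ 2 = 4 * k ^ 2 - γ₀ ^ 2 := by
      rw [hγ', Real.sq_sqrt (by linarith)]
    exact_mod_cast h
  have hs : (σ : ℂ) ^ 2 = 1 := by
    rcases hσ with rfl | rfl <;> norm_num
  set a : ℂ := (-(γ₀ : ℂ) + (σ : ℂ) * Complex.I * (γ' : ℂ)) / 2 with ha
  have dispersion : a ^ 2 + (k : ℂ) ^ 2 + γ₀ * a = 0 := by
    rw [ha]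
    linear_combination (σ ^ 2 * (γ' : ℂ) ^ 2 / 4) * Complex.I_sq - (γ' : ℂ) ^ 2 / 4 * hs - hγ / 4
  have hu' : u = fun p : ℝ × ℝ =>
      1 * (Complex.exp (a * c * p.1) * Complex.exp (Complex.I * k * p.2)) := by
    simpa only [one_mul] using hu
  rw [hu']
  simp only [pdtC_const_mul_exp_mul_exp, pdzC_const_mul_exp_mul_exp]
  field_simp
  linear_combination (Complex.exp (c * a * p.1) * Complex.exp (Complex.I * k * p.2)) *
    (dispersion - (k : ℂ) ^ 2 * Complex.I_sq)
end

section
/- Let ħ > 0, m > 0, γ₀ ∈ ℝ, γ ∈ ℝ³, let V : ℝ³ → ℝ, and let Ψ : ℝ × ℝ³ → ℂ, (t, r) ↦ Ψ(t, r), be C². Suppose Ψ satisfies the non-conservative Schrödinger equation i ħ ∂_t Ψ = −(ħ²/(2m)) ΔΨ + V(r) Ψ − i ħ (γ₀/2) Ψ − (ħ²/(2m)) γ · ∇Ψ, where Δ and ∇ act on the spatial variables. Define the probability density ρ(t, r) = Ψ̄(t, r) Ψ(t, r) (a real-valued function) and the probability current J(t, r) = (ħ/(2mi)) ( Ψ̄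 ∇Ψ − Ψ ∇Ψ̄ ) (an ℝ³-valued function). Then at every point (t, r): ∂_t ρ = −div J − γ · J − γ₀ ρ, where div is the spatial divergence and · the Euclidean inner product on ℝ³. -/
open Complex MeasureTheory

/-- Spatial partial derivative `∂_i` of a complex-valued wave function on
`ℝ × ℝ³ = (t, r)`. -/
noncomputable def pdsp (i : Fin 3) (Ψ : ℝ × EuclideanSpace ℝ (Fin 3) → ℂ)
    (p : ℝ × EuclideanSpace ℝ (Fin 3)) : ℂ :=
  fderiv ℝ (fun r' => Ψ (p.1, r')) p.2 (EuclideanSpace.single i 1)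

/-- The probability density is the squared modulus of the wave function. -/
lemma real_eq_re_sq_add_im_sq {x : ℝ} {z : ℂ} (h : (x : ℂ) = (starRingEnd ℂ) z * z) :
    x = z.re * z.re + z.im * z.im := by
  simpa using congrArg Complex.re h

/-- The probability current in terms of real and imaginary parts. -/
lemma current_eq_re_im {x hbar m : ℝ} (hm : m ≠ 0) {z w : ℂ}
    (h : (x : ℂ) = (hbar : ℂ) / (2 * (m : ℂ) * Complex.I) *
      ((starRingEnd ℂ) z * w - z * (starRingEnd ℂ) w)) :
    x = hbar / m * (z.re * w.im - z.im * w.re) := by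
  have hmC : (m : ℂ) ≠ 0 := by exact_mod_cast hm
  have hcoef : (hbar : ℂ) / (2 * (m : ℂ) * Complex.I)
      = ((-(hbar / (2 * m)) : ℝ) : ℂ) * Complex.I := by
    push_cast
    field_simp
    simp
  rw [hcoef] at h
  have h' := congrArg Complex.re h
  simp only [ofReal_re, ofReal_im, mul_re, mul_im, sub_re, sub_im, conj_re, conj_im,
    I_re, I_im] at h'
  rw [h']
  field_simp
  ring

/-- Spatial derivatives of a `C²` wave function are differentiable in space. -/
lemma differentiable_pdsp {Ψ : ℝ × EuclideanSpace ℝ (Fin 3) → ℂ} (hΨ : ContDiff ℝ 2 Ψ)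
    (i : Fin 3) (t : ℝ) : Differentiable ℝ (fun r => pdsp i Ψ (t, r)) := by
  have hf : ContDiff ℝ 2 (fun r => Ψ (t, r)) := hΨ.comp (by fun_prop)
  have hd : Differentiable ℝ (fderiv ℝ (fun r => Ψ (t, r))) :=
    (hf.fderiv_right (m := 1) (by norm_num)).differentiable (by norm_num)
  exact fun r => (hd r).clm_apply (differentiableAt_const _)

/-- The directional derivative of the current: the mixed first-order terms cancel. -/
lemma fderiv_current {Ψ : ℝ × EuclideanSpace ℝ (Fin 3) → ℂ} (hΨ : ContDiff ℝ 2 Ψ)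
    (c : ℝ) (i : Fin 3) (t : ℝ) (r : EuclideanSpace ℝ (Fin 3)) :
    fderiv ℝ (fun r' => c * ((Ψ (t, r')).re * (pdsp i Ψ (t, r')).im
        - (Ψ (t, r')).im * (pdsp i Ψ (t, r')).re)) r (EuclideanSpace.single i 1)
      = c * ((Ψ (t, r)).re * (pdsp i (pdsp i Ψ) (t, r)).im
        - (Ψ (t, r)).im * (pdsp i (pdsp i Ψ) (t, r)).re) := by
  have hf : HasFDerivAt (fun r' => Ψ (t, r')) (fderiv ℝ (fun r' => Ψ (t, r')) r) r :=
    ((hΨ.differentiable (by norm_num)).comp (by fun_prop :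
      Differentiable ℝ (fun r' : EuclideanSpace ℝ (Fin 3) => (t, r'))) r).hasFDerivAt
  have hg := (differentiable_pdsp hΨ i t r).hasFDerivAt
  have hfr := reCLM.hasFDerivAt.comp r hf
  have hfi := imCLM.hasFDerivAt.comp r hf
  have hgr := reCLM.hasFDerivAt.comp r hg
  have hgi := imCLM.hasFDerivAt.comp r hg
  have hJ := ((hfr.mul hgi).sub (hfi.mul hgr)).const_mul c
  have key := congrArg (fun L => L (EuclideanSpace.single i (1 : ℝ))) hJ.fderiv
  refine key.trans ?_
  simp [pdsp, -mul_eq_mul_left_iff]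
  ring

/-- The time derivative of the density. -/
lemma deriv_density {f : ℝ → ℂ} {t : ℝ} (hf : DifferentiableAt ℝ f t) :
    deriv (fun s => (f s).re * (f s).re + (f s).im * (f s).im) t
      = 2 * ((f t).re * (deriv f t).re + (f t).im * (deriv f t).im) := by
  have hr := reCLM.hasFDerivAt.comp_hasDerivAt t hf.hasDerivAt
  have hi := imCLM.hasFDerivAt.comp_hasDerivAt t hf.hasDerivAt
  refine ((hr.mul hr).add (hi.mul hi)).deriv.trans ?_
  simp
  ring

/-- Modified continuity equation for the non-conservative Schrödinger equation:
`∂_t ρ = −div J − γ·J − γ₀ ρ`. -/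
theorem stmt_14 (hbar m : ℝ) (hhb : 0 < hbar) (hm : 0 < m)
    (γ₀ : ℝ) (γ : Fin 3 → ℝ) (V : EuclideanSpace ℝ (Fin 3) → ℝ)
    (Ψ : ℝ × EuclideanSpace ℝ (Fin 3) → ℂ) (hΨ : ContDiff ℝ 2 Ψ)
    (hSch : ∀ (t : ℝ) (r : EuclideanSpace ℝ (Fin 3)),
      Complex.I * (hbar : ℂ) * deriv (fun t' => Ψ (t', r)) t
        = -((hbar ^ 2 / (2 * m) : ℝ) : ℂ) * (∑ i : Fin 3, pdsp i (pdsp i Ψ) (t, r))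
          + (V r : ℂ) * Ψ (t, r)
          - Complex.I * (hbar : ℂ) * ((γ₀ / 2 : ℝ) : ℂ) * Ψ (t, r)
          - ((hbar ^ 2 / (2 * m) : ℝ) : ℂ) *
              ∑ i : Fin 3, (γ i : ℂ) * pdsp i Ψ (t, r))
    (ρ : ℝ × EuclideanSpace ℝ (Fin 3) → ℝ)
    (hρ : ∀ p, (ρ p : ℂ) = (starRingEnd ℂ) (Ψ p) * Ψ p)
    (J : Fin 3 → ℝ × EuclideanSpace ℝ (Fin 3) → ℝ)
    (hJ : ∀ i p, (J i p : ℂ) = (hbar : ℂ) / (2 * (m : ℂ) * Complex.I) *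
      ((starRingEnd ℂ) (Ψ p) * pdsp i Ψ p - Ψ p * (starRingEnd ℂ) (pdsp i Ψ p))) :
    ∀ (t : ℝ) (r : EuclideanSpace ℝ (Fin 3)),
      deriv (fun t' => ρ (t', r)) t
        = -(∑ i : Fin 3,
              fderiv ℝ (fun r' => J i (t, r')) r (EuclideanSpace.single i 1))
          - (∑ i : Fin 3, γ i * J i (t, r))
          - γ₀ * ρ (t, r) := by
  intro t r
  have hm0 : m ≠ 0 := hm.ne'
  have hρ' : ∀ p, ρ p = (Ψ p).re * (Ψ p).re + (Ψ p).im * (Ψ p).im :=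
    fun p => real_eq_re_sq_add_im_sq (hρ p)
  have hJ' : ∀ i p, J i p
      = hbar / m * ((Ψ p).re * (pdsp i Ψ p).im - (Ψ p).im * (pdsp i Ψ p).re) :=
    fun i p => current_eq_re_im hm0 (hJ i p)
  have hdt : DifferentiableAt ℝ (fun t' => Ψ (t', r)) t :=
    (hΨ.differentiable (by norm_num)).comp (by fun_prop :
      Differentiable ℝ (fun t' : ℝ => (t', r))) t
  simp only [hρ', hJ', fderiv_current hΨ, deriv_density hdt]
  have hcoef : hbar ^ 2 / (2 * m) = hbar * (hbar / m) / 2 := by field_simp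
  have hS := hSch t r
  simp only [Fin.sum_univ_three, hcoef] at hS ⊢
  have hre := congrArg Complex.re hS
  have him := congrArg Complex.im hS
  simp only [neg_re, neg_im, ofReal_re, ofReal_im, mul_re, mul_im, sub_re, sub_im, add_re,
    add_im, I_re, I_im] at hre him
  refine mul_left_cancel₀ hhb.ne' ?_
  linear_combination 2 * (Ψ (t, r)).re * him - 2 * (Ψ (t, r)).im * hre
end
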